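/- Let Y be a finite-dimensional linear subspace of c₀. Then Y has property-(HB) in c₀ if and only if Y has property-(U) in c₀ and there exists a bi-contractive linear projection P : c₀ → c₀ with range P = Y such that both Y and (I − P)(c₀) are L₁-predual spaces. -/

import Mathlib

open scoped ENNReal

noncomputable section

/-- The annihilator of a subspace `Y` in the continuous dual. -/
def annih {X : Type*} [NormedAddCommGroup X] [NormedSpace ℝ X] (Y : Submodule ℝ X) :
    Submodule ℝ (X →L[ℝ] ℝ) where
  carrier := {f | ∀ y ∈ Y, f y = 0}
  add_mem' := by intro f g hf hg y hy; simp [hf y hy, hg y hy]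
  zero_mem' := by intro y hy; simp
  smul_mem' := by intro c f hf y hy; simp [hf y hy]

/-- `F` is a norm-preserving extension of `f : Y* → ℝ`. -/
def IsNPExtension {X : Type*} [NormedAddCommGroup X] [NormedSpace ℝ X] (Y : Submodule ℝ X)
    (f : Y →L[ℝ] ℝ) (F : X →L[ℝ] ℝ) : Prop :=
  (∀ y : Y, F y = f y) ∧ ‖F‖ = ‖f‖

/-- property-(U) -/
def PropU {X : Type*} [NormedAddCommGroup X] [NormedSpace ℝ X] (Y : Submodule ℝ X) : Prop :=
  ∀ f : Y →L[ℝ] ℝ, ∃! F : X →L[ℝ] ℝ, IsNPExtension Y f F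

/-- property-(wU) -/
def PropwU {X : Type*} [NormedAddCommGroup X] [NormedSpace ℝ X] (Y : Submodule ℝ X) : Prop :=
  ∀ f : Y →L[ℝ] ℝ, (∃ y₀ : Y, ‖y₀‖ = 1 ∧ ‖f‖ = |f y₀|) →
    ∃! F : X →L[ℝ] ℝ, IsNPExtension Y f F

/-- property-(SU) -/
def PropSU {X : Type*} [NormedAddCommGroup X] [NormedSpace ℝ X] (Y : Submodule ℝ X) : Prop :=
  ∃ G : Submodule ℝ (X →L[ℝ] ℝ), IsClosed (G : Set (X →L[ℝ] ℝ)) ∧ IsCompl G (annih Y) ∧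
    ∀ g ∈ G, ∀ h ∈ annih Y, h ≠ 0 → ‖g‖ < ‖g + h‖

/-- property-(HB) -/
def PropHB {X : Type*} [NormedAddCommGroup X] [NormedSpace ℝ X] (Y : Submodule ℝ X) : Prop :=
  ∃ G : Submodule ℝ (X →L[ℝ] ℝ), IsClosed (G : Set (X →L[ℝ] ℝ)) ∧ IsCompl G (annih Y) ∧
    ∀ g ∈ G, ∀ h ∈ annih Y, h ≠ 0 → ‖g‖ < ‖g + h‖ ∧ ‖h‖ ≤ ‖g + h‖

/-- M-ideal -/
def MIdeal {X : Type*} [NormedAddCommGroup X] [NormedSpace ℝ X] (Y : Submodule ℝ X) : Prop :=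
  ∃ G : Submodule ℝ (X →L[ℝ] ℝ), IsClosed (G : Set (X →L[ℝ] ℝ)) ∧ IsCompl G (annih Y) ∧
    ∀ g ∈ G, ∀ h ∈ annih Y, ‖g + h‖ = ‖g‖ + ‖h‖



open scoped ZeroAtInfty

universe v

/-- A Banach space is an `L₁`-predual if its dual is isometric to `L₁(μ)` for some measure. -/
def IsL1Predual (E : Type*) [NormedAddCommGroup E] [NormedSpace ℝ E] : Prop :=
  ∃ (Ω : Type v) (_ : MeasurableSpace Ω) (μ : MeasureTheory.Measure Ω),
    Nonempty ((E →L[ℝ] ℝ) ≃ₗᵢ[ℝ] MeasureTheory.Lp ℝ 1 μ)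

namespace HBaux

open MeasureTheory Filter Topology

theorem l1_of_basis {E : Type*} [NormedAddCommGroup E] [NormedSpace ℝ E] {ι : Type} [Countable ι]
    (e : ι → E) (c : ι → E →ₗ[ℝ] ℝ) (hs : ∀ x, HasSum (fun i => c i x • e i) x)
    (hc : ∀ i x, |c i x| ≤ ‖x‖)
    (hn : ∀ (F : Finset ι) (t : ι → ℝ), (∀ i, |t i| ≤ 1) → ‖∑ i ∈ F, t i • e i‖ ≤ 1)
    (h1 : ∀ i, c i (e i) = 1) (h0 : ∀ i j, i ≠ j → c i (e j) = 0) :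
    IsL1Predual.{v} E := by
  classical
  have hfin : ∀ (f : E →L[ℝ] ℝ) (F : Finset ι), ∑ i ∈ F, |f (e i)| ≤ ‖f‖ := by
    intro f F
    have h := f.le_opNorm (∑ i ∈ F, (SignType.sign (f (e i)) : ℝ) • e i)
    have h2 : ‖∑ i ∈ F, (SignType.sign (f (e i)) : ℝ) • e i‖ ≤ 1 := by
      apply hn F (fun i => (SignType.sign (f (e i)) : ℝ))
      intro i
      rcases lt_trichotomy (f (e i)) 0 with h | h | h <;> simp [h]
    have h3 : f (∑ i ∈ F, (SignType.sign (f (e i)) : ℝ) • e i) = ∑ i ∈ F, |f (e i)| := by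
      simp [map_sum, sign_mul_self]
    rw [h3] at h
    calc _ ≤ _ := le_abs_self _
      _ ≤ _ := h
      _ ≤ ‖f‖ * 1 := by gcongr
      _ = _ := mul_one _
  have hsum : ∀ f : E →L[ℝ] ℝ, Summable (fun i => |f (e i)|) := fun f =>
    summable_of_sum_le (fun _ => abs_nonneg _) (hfin f)
  have hnorm : ∀ f : E →L[ℝ] ℝ, ∑' i, |f (e i)| = ‖f‖ := by
    intro f
    apply le_antisymm
    · exact (hsum f).tsum_le_of_sum_le (hfin f)
    · refine f.opNorm_le_bound (tsum_nonneg fun _ => abs_nonneg _) fun x => ?_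
      have hx := (hs x).mapL f
      have hb : Summable (fun i => |f (e i)| * ‖x‖) := (hsum f).mul_right _
      rw [← hx.tsum_eq, ← tsum_mul_right]
      refine tsum_of_norm_bounded hb.hasSum fun i => ?_
      simp only [map_smul, smul_eq_mul, norm_mul, Real.norm_eq_abs]
      rw [mul_comm]
      gcongr
      exact hc i x
  let Ω := ULift.{v} ι
  letI : MeasurableSpace Ω := ⊤
  haveI : MeasurableSingletonClass Ω := ⟨fun _ => trivial⟩
  have hint : ∀ f : E →L[ℝ] ℝ, Integrable (fun i : Ω => f (e i.down)) Measure.count := by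
    intro f
    rw [integrable_count_iff]
    exact (Equiv.ulift.summable_iff (f := fun i => |f (e i)|)).2 (hsum f)
  refine ⟨Ω, inferInstance, Measure.count, ⟨?_⟩⟩
  let L : (E →L[ℝ] ℝ) →ₗ[ℝ] Lp ℝ 1 (Measure.count : Measure Ω) :=
    { toFun := fun f => (hint f).toL1
      map_add' := fun f g => Integrable.toL1_add _ _ (hint f) (hint g)
      map_smul' := fun r f => Integrable.toL1_smul _ (hint f) r }
  have hL : ∀ f, ‖L f‖ = ‖f‖ := by
    intro f
    have : ‖L f‖ = ∫ i : Ω, ‖f (e i.down)‖ ∂Measure.count := by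
      exact L1.norm_of_fun_eq_integral_norm (hint f)
    rw [this, integral_countable (hint f).norm, ← hnorm f, ← Equiv.ulift.tsum_eq (fun i => |f (e i)|)]
    simp [Measure.real]
    rfl
  let LI : (E →L[ℝ] ℝ) →ₗᵢ[ℝ] Lp ℝ 1 (Measure.count : Measure Ω) := ⟨L, hL⟩
  refine LinearIsometryEquiv.ofSurjective LI ?_
  intro u
  have hu : Integrable u Measure.count := L1.integrable_coeFn u
  have hus : Summable (fun i : ι => |u ⟨i⟩|) := by
    rw [integrable_count_iff] at hu
    exact (Equiv.ulift.symm.summable_iff (f := fun i : Ω => |u i|)).2 hu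
  have hbs : ∀ x, Summable (fun i => c i x * u ⟨i⟩) := by
    intro x
    refine Summable.of_norm_bounded (hus.mul_left ‖x‖) fun i => ?_
    rw [norm_mul]
    simp only [Real.norm_eq_abs]
    gcongr
    exact hc i x
  let f0 : E →ₗ[ℝ] ℝ :=
    { toFun := fun x => ∑' i, c i x * u ⟨i⟩
      map_add' := fun x y => by
        simp only [map_add, add_mul]
        exact (hbs x).tsum_add (hbs y)
      map_smul' := fun r x => by
        simp only [map_smul, smul_eq_mul, mul_assoc, RingHom.id_apply]
        exact tsum_mul_left }
  let f : E →L[ℝ] ℝ := f0.mkContinuous (∑' i, |u ⟨i⟩|) (by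
    intro x
    rw [← tsum_mul_right]
    refine tsum_of_norm_bounded (hus.mul_right _).hasSum fun i => ?_
    rw [norm_mul, mul_comm]
    simp only [Real.norm_eq_abs]
    gcongr
    exact hc i x)
  have hfe : ∀ i, f (e i) = u ⟨i⟩ := by
    intro i
    change ∑' j, c j (e i) * u ⟨j⟩ = u ⟨i⟩
    rw [tsum_eq_single i]
    · simp [h1]
    · intro j hj
      simp [h0 j i hj]
  refine ⟨f, ?_⟩
  change (hint f).toL1 = u
  rw [← Integrable.toL1_coeFn u hu, Integrable.toL1_eq_toL1_iff]
  refine Eventually.of_forall fun i => ?_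
  exact hfe i.down

/-- unit vector -/
def ee (i : ℕ) : C₀(ℕ, ℝ) :=
  ⟨⟨fun j => if j = i then 1 else 0, continuous_of_discreteTopology⟩, by
    rw [cocompact_eq_cofinite]
    refine tendsto_const_nhds.congr' ?_
    have : ∀ᶠ j in cofinite, j ≠ i := (Set.finite_singleton i).compl_mem_cofinite
    filter_upwards [this] with j hj
    simp [hj]⟩

theorem ee_apply (i j : ℕ) : ee i j = if j = i then 1 else 0 := rfl

theorem norm_le' {x : C₀(ℕ, ℝ)} {C : ℝ} (hC : 0 ≤ C) : ‖x‖ ≤ C ↔ ∀ i, |x i| ≤ C := by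
  rw [← ZeroAtInftyContinuousMap.norm_toBCF_eq_norm, BoundedContinuousFunction.norm_le hC]
  rfl

theorem apply_le (x : C₀(ℕ, ℝ)) (i : ℕ) : |x i| ≤ ‖x‖ := (norm_le' (norm_nonneg _)).1 le_rfl i

/-- evaluation, linear -/
def evl (i : ℕ) : C₀(ℕ, ℝ) →ₗ[ℝ] ℝ where
  toFun x := x i
  map_add' _ _ := rfl
  map_smul' _ _ := rfl

/-- evaluation, continuous -/
def ev (i : ℕ) : C₀(ℕ, ℝ) →L[ℝ] ℝ :=
  (evl i).mkContinuous 1 (fun x => by rw [one_mul]; exact apply_le x i)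

theorem ev_apply (i : ℕ) (x : C₀(ℕ, ℝ)) : ev i x = x i := rfl

theorem ev_norm (i : ℕ) : ‖ev i‖ ≤ 1 := LinearMap.mkContinuous_norm_le _ zero_le_one _

theorem sum_apply' (F : Finset ℕ) (t : ℕ → ℝ) (j : ℕ) :
    (∑ i ∈ F, t i • ee i) j = if j ∈ F then t j else 0 := by
  rw [← ev_apply, map_sum]
  simp [ev_apply, ee_apply]

theorem hasSum_ee (x : C₀(ℕ, ℝ)) : HasSum (fun i => x i • ee i) x := by
  rw [HasSum, Metric.tendsto_nhds]
  intro ε hε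
  have hx : Tendsto x cofinite (𝓝 0) := by
    rw [← cocompact_eq_cofinite]; exact x.zero_at_infty'
  have h2 := (Metric.tendsto_nhds.1 hx) (ε/2) (by positivity)
  have hfin : {i | ¬ dist (x i) 0 < ε / 2}.Finite := h2
  filter_upwards [Filter.eventually_ge_atTop hfin.toFinset] with F hF
  rw [dist_eq_norm]
  refine lt_of_le_of_lt ((norm_le' (C := ε/2) (by positivity)).2 fun j => ?_) (by linarith)
  rw [ZeroAtInftyContinuousMap.sub_apply, sum_apply']
  split_ifs with h
  · simp; positivity
  · have : j ∉ hfin.toFinset := fun h' => h (hF h')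
    simp at this
    simpa using this.le

theorem l1_coord (S : Set ℕ) (Z : Submodule ℝ C₀(ℕ, ℝ)) (hZ : ∀ x, x ∈ Z ↔ ∀ i ∉ S, x i = 0) :
    IsL1Predual.{v} Z := by
  classical
  have hm : ∀ i : S, ee i ∈ Z := fun i => (hZ _).2 fun j hj => by
    rw [ee_apply, if_neg]; rintro rfl; exact hj i.2
  refine l1_of_basis (ι := S) (fun i => ⟨ee i, hm i⟩) (fun i => (evl i).comp Z.subtype) ?_ ?_ ?_ ?_ ?_
  · intro x
    have h := hasSum_ee (x : C₀(ℕ, ℝ))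
    rw [← hasSum_subtype_iff_of_support_subset (s := S)] at h
    · have hi : IsInducing (Z.subtype) := IsInducing.subtypeVal
      rw [← hi.hasSum_iff]
      exact h
    · intro i hi
      by_contra hc
      exact hi (by simp [(hZ _).1 x.2 i hc])
  · intro i x
    exact apply_le x i
  · intro F t ht
    rw [← Submodule.norm_coe]
    refine (norm_le' zero_le_one).2 fun j => ?_
    rw [← ev_apply]
    simp only [Submodule.coe_sum, Submodule.coe_smul, map_sum, map_smul, ev_apply, ee_apply]
    by_cases hj : ∃ h : j ∈ S, (⟨j, h⟩ : S) ∈ F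
    · obtain ⟨h, hF⟩ := hj
      rw [Finset.sum_eq_single_of_mem _ hF]
      · simpa using ht ⟨j, h⟩
      · intro b _ hb
        rw [if_neg]; · simp
        rintro rfl; exact hb rfl
    · rw [Finset.sum_eq_zero]; · simp
      intro b hb
      rw [if_neg]; · simp
      rintro rfl; exact hj ⟨b.2, hb⟩
  · intro i; change ee i i = 1; simp [ee_apply]
  · intro i j hij; change ee j i = 0
    rw [ee_apply, if_neg]; exact fun h => hij (Subtype.ext h)

theorem exists_norm (u : C₀(ℕ, ℝ)) (hu : u ≠ 0) : ∃ j, |u j| = ‖u‖ := by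
  obtain ⟨i, hi⟩ : ∃ i, u i ≠ 0 := by
    by_contra h; push Not at h; exact hu (ZeroAtInftyContinuousMap.ext h)
  have hc : Continuous fun j => |u j| := continuous_of_discreteTopology
  have ht : Tendsto (fun j => |u j|) (cocompact ℕ) (𝓝 0) := by
    simpa using (u.zero_at_infty').abs
  obtain ⟨j, hj⟩ := hc.exists_forall_ge' i
    ((ht.eventually (gt_mem_nhds (abs_pos.2 hi))).mono fun _ h => h.le)
  exact ⟨j, le_antisymm (apply_le u j) ((norm_le' (abs_nonneg _)).2 hj)⟩

/-- The structure of contractive involutions on c₀. -/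
theorem invol (T : C₀(ℕ, ℝ) →L[ℝ] C₀(ℕ, ℝ)) (hT : ∀ x, ‖T x‖ ≤ ‖x‖) (hTT : ∀ x, T (T x) = x)
    (i : ℕ) : ∃ j, ∃ s : ℝ, (s = 1 ∨ s = -1) ∧ ∀ x, T x i = s * x j := by
  have hei : ‖ee i‖ = 1 := by
    apply le_antisymm
    · refine (norm_le' zero_le_one).2 fun j => ?_
      rw [ee_apply]; split_ifs <;> simp
    · have := apply_le (ee i) i
      simpa [ee_apply] using this
  have hn : ‖T (ee i)‖ = 1 := by
    apply le_antisymm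
    · exact (hT _).trans hei.le
    · have := hT (T (ee i))
      rwa [hTT, hei] at this
  obtain ⟨j, hj⟩ := exists_norm (T (ee i)) (by intro h; rw [h] at hn; simp at hn)
  rw [hn] at hj
  set s := T (ee i) j with hs
  have hs' : s = 1 ∨ s = -1 := eq_or_eq_neg_of_abs_eq hj
  have key0 : ∀ x : C₀(ℕ, ℝ), ‖x‖ ≤ 1 → x i = 0 → T x j = 0 := by
    intro x hx hxi
    have hb : ∀ r : ℝ, |r| = 1 → |s + r * T x j| ≤ 1 := by
      intro r hr
      have h1 : ‖ee i + r • x‖ ≤ 1 := by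
        refine (norm_le' zero_le_one).2 fun k => ?_
        rw [ZeroAtInftyContinuousMap.add_apply, ZeroAtInftyContinuousMap.smul_apply, ee_apply]
        split_ifs with h
        · simp [h, hxi]
        · have := (apply_le x k).trans hx
          simpa [abs_mul, hr] using this
      have h2 := (apply_le (T (ee i + r • x)) j).trans ((hT _).trans h1)
      simpa [map_add] using h2
    have a1 := abs_le.1 (hb 1 (by simp))
    have a2 := abs_le.1 (hb (-1) (by simp))
    rcases hs' with h | h <;> rw [h] at a1 a2 <;> linarith [a1.1, a1.2, a2.1, a2.2]
  have key1 : ∀ x : C₀(ℕ, ℝ), x i = 0 → T x j = 0 := by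
    intro x hxi
    by_cases hx : x = 0
    · simp [hx]
    have hpos : 0 < ‖x‖ := norm_pos_iff.2 hx
    have := key0 (‖x‖⁻¹ • x) (by rw [norm_smul, norm_inv, norm_norm, inv_mul_cancel₀ hpos.ne'])
      (by simp [hxi])
    simpa [hx] using this
  have key2 : ∀ x : C₀(ℕ, ℝ), T x j = s * x i := by
    intro x
    have := key1 (x - x i • ee i) (by simp [ee_apply])
    rw [map_sub, map_smul, ZeroAtInftyContinuousMap.sub_apply,
      ZeroAtInftyContinuousMap.smul_apply, smul_eq_mul] at this
    linarith
  refine ⟨j, s, hs', fun x => ?_⟩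
  have := key2 (T x)
  rw [hTT] at this
  rw [this, ← mul_assoc]
  rcases hs' with h | h <;> rw [h] <;> simp

theorem refl_contr (P : C₀(ℕ, ℝ) →L[ℝ] C₀(ℕ, ℝ)) (h1 : ∀ x, ‖P x‖ ≤ ‖x‖)
    (h2 : ∀ x, ‖x - P x‖ ≤ ‖x‖) (x : C₀(ℕ, ℝ)) : ‖(2 : ℝ) • P x - x‖ ≤ ‖x‖ := by
  have main : ∀ x : C₀(ℕ, ℝ), ‖x‖ ≤ 1 → ‖(2 : ℝ) • P x - x‖ ≤ 1 := by
    intro x hx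
    refine (norm_le' zero_le_one).2 fun i => ?_
    set y := x - x i • ee i with hy
    have hyi : y i = 0 := by simp [hy, ee_apply]
    have hx' : P x i = x i * P (ee i) i + P y i := by
      simp [hy]
    have hb : ∀ r : ℝ, |r| = 1 → ‖r • ee i + y‖ ≤ 1 := by
      intro r hr
      refine (norm_le' zero_le_one).2 fun k => ?_
      rw [ZeroAtInftyContinuousMap.add_apply, ZeroAtInftyContinuousMap.smul_apply, ee_apply]
      split_ifs with h
      · simp [h, hyi, hr]
      · have := (apply_le x k).trans hx
        simpa [hy, ee_apply, h] using this
    have c1 : ∀ r : ℝ, |r| = 1 → |r * P (ee i) i + P y i| ≤ 1 := by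
      intro r hr
      have := (apply_le _ i).trans ((h1 _).trans (hb r hr))
      simpa using this
    have c2 : ∀ r : ℝ, |r| = 1 → |r - (r * P (ee i) i + P y i)| ≤ 1 := by
      intro r hr
      have := (apply_le _ i).trans ((h2 _).trans (hb r hr))
      simpa [hyi, ee_apply] using this
    have a1 := abs_le.1 (c1 1 (by simp))
    have a2 := abs_le.1 (c1 (-1) (by simp))
    have a3 := abs_le.1 (c2 1 (by simp))
    have a4 := abs_le.1 (c2 (-1) (by simp))
    have hxi := abs_le.1 ((apply_le x i).trans hx)
    rw [ZeroAtInftyContinuousMap.sub_apply, ZeroAtInftyContinuousMap.smul_apply, smul_eq_mul, hx']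
    generalize P (ee i) i = a at *
    generalize P y i = b at *
    generalize x i = t at *
    have m : |(2 * a - 1) * t| ≤ |2 * a - 1| := by
      rw [abs_mul]
      exact mul_le_of_le_one_right (abs_nonneg _) (abs_le.2 hxi)
    have m2 := abs_le.1 m
    obtain ⟨a11, a12⟩ := a1
    obtain ⟨a21, a22⟩ := a2
    obtain ⟨a31, a32⟩ := a3
    obtain ⟨a41, a42⟩ := a4
    obtain ⟨m21, m22⟩ := m2
    rw [abs_le]
    rcases abs_cases (2 * a - 1) with ⟨h, _⟩ | ⟨h, _⟩ <;> rw [h] at m21 m22 <;>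
      constructor <;> nlinarith
  by_cases hx : x = 0
  · simp [hx]
  have hpos : 0 < ‖x‖ := norm_pos_iff.2 hx
  have := main (‖x‖⁻¹ • x) (by rw [norm_smul, norm_inv, norm_norm, inv_mul_cancel₀ hpos.ne'])
  have e : (2 : ℝ) • P (‖x‖⁻¹ • x) - ‖x‖⁻¹ • x = ‖x‖⁻¹ • ((2 : ℝ) • P x - x) := by
    rw [map_smul]; module
  rw [e, norm_smul, norm_inv, norm_norm, inv_mul_le_iff₀ hpos] at this
  simpa using this

theorem exists_proj {X : Type*} [NormedAddCommGroup X] [NormedSpace ℝ X] (Y : Submodule ℝ X)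
    [FiniteDimensional ℝ Y] (G : Submodule ℝ (X →L[ℝ] ℝ)) (hG : IsCompl G (annih Y)) :
    ∃ P : X →L[ℝ] X, (∀ x, P x ∈ Y) ∧ (∀ y ∈ Y, P y = y) ∧
      ∀ f : X →L[ℝ] ℝ, f.comp P ∈ G := by
  let b := Module.finBasis ℝ Y
  have hex : ∀ i, ∃ g ∈ G, ∀ y : Y, g y = b.coord i y := by
    intro i
    obtain ⟨F, hF, -⟩ := exists_extension_norm_eq Y (LinearMap.toContinuousLinearMap (b.coord i))
    have : F ∈ G ⊔ annih Y := by rw [hG.sup_eq_top]; trivial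
    obtain ⟨g, hg, h, hh, rfl⟩ := Submodule.mem_sup.1 this
    refine ⟨g, hg, fun y => ?_⟩
    have h1 := hF y
    have h2 := hh y y.2
    simp only [ContinuousLinearMap.add_apply, h2, add_zero] at h1
    exact h1
  choose g hg hgy using hex
  refine ⟨∑ i, (g i).smulRight (b i : X), fun x => ?_, fun y hy => ?_, fun f => ?_⟩
  · rw [ContinuousLinearMap.sum_apply]
    exact Submodule.sum_mem _ fun i _ => Y.smul_mem _ (b i).2
  · rw [ContinuousLinearMap.sum_apply]
    have := congrArg Subtype.val (b.sum_repr ⟨y, hy⟩)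
    rw [Submodule.coe_sum] at this
    conv_rhs => rw [← show ((⟨y, hy⟩ : Y) : X) = y from rfl, ← this]
    refine Finset.sum_congr rfl fun i _ => ?_
    simp [hgy i ⟨y, hy⟩]
  · have : f.comp (∑ i, (g i).smulRight (b i : X)) = ∑ i, f (b i) • g i := by
      ext x
      simp [ContinuousLinearMap.sum_apply, mul_comm]
    rw [this]
    exact Submodule.sum_mem _ fun i _ => G.smul_mem _ (hg i)

theorem propU_of_HB {X : Type*} [NormedAddCommGroup X] [NormedSpace ℝ X] (Y : Submodule ℝ X)
    (G : Submodule ℝ (X →L[ℝ] ℝ)) (hG : IsCompl G (annih Y))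
    (hs : ∀ g ∈ G, ∀ h ∈ annih Y, h ≠ 0 → ‖g‖ < ‖g + h‖) : PropU Y := by
  intro f
  obtain ⟨F, hF, hFn⟩ := exists_extension_norm_eq Y f
  have hdec : ∀ F : X →L[ℝ] ℝ, ∃ g ∈ G, ∃ h ∈ annih Y, g + h = F := by
    intro F
    have : F ∈ G ⊔ annih Y := by rw [hG.sup_eq_top]; trivial
    exact Submodule.mem_sup.1 this
  have key : ∀ F : X →L[ℝ] ℝ, IsNPExtension Y f F → F ∈ G := by
    rintro F ⟨hF, hFn⟩
    obtain ⟨g, hg, h, hh, rfl⟩ := hdec F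
    by_cases h0 : h = 0
    · simpa [h0] using hg
    exfalso
    have hlt := hs g hg h hh h0
    rw [hFn] at hlt
    refine absurd ?_ (not_le.2 hlt)
    refine f.opNorm_le_bound (norm_nonneg _) fun y => ?_
    rw [← hF y, ContinuousLinearMap.add_apply, hh y y.2, add_zero]
    exact g.le_opNorm y
  refine ⟨F, ⟨hF, hFn⟩, fun F' hF' => ?_⟩
  have h1 := key F ⟨hF, hFn⟩
  have h2 := key F' hF'
  have h3 : F' - F ∈ annih Y := by
    intro y hy
    have e1 := hF ⟨y, hy⟩
    have e2 := hF'.1 ⟨y, hy⟩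
    simp only at e1 e2
    simp [e1, e2]
  have := Submodule.disjoint_def.1 hG.disjoint _ (G.sub_mem h2 h1) h3
  exact sub_eq_zero.1 this

theorem HB_of_U {X : Type*} [NormedAddCommGroup X] [NormedSpace ℝ X] (Y : Submodule ℝ X)
    (hU : PropU Y) (P : X →L[ℝ] X) (hPP : P.comp P = P) (h1 : ‖P‖ ≤ 1)
    (h2 : ‖ContinuousLinearMap.id ℝ X - P‖ ≤ 1) (hr : LinearMap.range P.toLinearMap = Y) :
    PropHB Y := by
  have hPm : ∀ x, P x ∈ Y := fun x => by rw [← hr]; exact ⟨x, rfl⟩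
  have hPy : ∀ y ∈ Y, P y = y := by
    intro y hy
    rw [← hr] at hy
    obtain ⟨x, rfl⟩ := hy
    exact congrArg (fun T : X →L[ℝ] X => T x) hPP
  let G : Submodule ℝ (X →L[ℝ] ℝ) :=
    { carrier := {f | f.comp P = f}
      add_mem' := by
        intro f g hf hg
        simp only [Set.mem_setOf_eq] at *
        rw [ContinuousLinearMap.add_comp, hf, hg]
      zero_mem' := by simp
      smul_mem' := by
        intro c f hf
        simp only [Set.mem_setOf_eq] at *
        rw [ContinuousLinearMap.smul_comp, hf] }
  have hGm : ∀ f, f ∈ G ↔ f.comp P = f := fun f => Iff.rfl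
  have hh0 : ∀ h ∈ annih Y, h.comp P = 0 := by
    intro h hh; ext x; exact hh _ (hPm x)
  refine ⟨G, ?_, ?_, ?_⟩
  · have : (G : Set (X →L[ℝ] ℝ)) = {f | f.comp P = f} := rfl
    rw [this]
    exact isClosed_eq (by fun_prop) continuous_id
  · constructor
    · rw [Submodule.disjoint_def]
      intro f hf hf'
      rw [← (hGm f).1 hf, hh0 f hf']
    · rw [codisjoint_iff, eq_top_iff]
      intro f _
      refine Submodule.mem_sup.2 ⟨f.comp P, ?_, f - f.comp P, ?_, by simp⟩
      · rw [hGm, ContinuousLinearMap.comp_assoc, hPP]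
      · intro y hy
        simp [hPy y hy]
  · intro g hg h hh hne
    have e1 : g = (g + h).comp P := by
      rw [ContinuousLinearMap.add_comp, hh0 h hh, (hGm g).1 hg, add_zero]
    have e2 : h = (g + h).comp (ContinuousLinearMap.id ℝ X - P) := by
      rw [ContinuousLinearMap.comp_sub, ← e1, ContinuousLinearMap.comp_id]; simp
    have n1 : ‖g‖ ≤ ‖g + h‖ := by
      calc ‖g‖ = ‖(g + h).comp P‖ := by rw [← e1]
        _ ≤ ‖g + h‖ * ‖P‖ := ContinuousLinearMap.opNorm_comp_le _ _
        _ ≤ ‖g + h‖ * 1 := by gcongr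
        _ = _ := mul_one _
    have n2 : ‖h‖ ≤ ‖g + h‖ := by
      calc ‖h‖ = ‖(g + h).comp (ContinuousLinearMap.id ℝ X - P)‖ := by rw [← e2]
        _ ≤ ‖g + h‖ * ‖ContinuousLinearMap.id ℝ X - P‖ := ContinuousLinearMap.opNorm_comp_le _ _
        _ ≤ ‖g + h‖ * 1 := by gcongr
        _ = _ := mul_one _
    refine ⟨lt_of_le_of_ne n1 fun heq => hne ?_, n2⟩
    let f : Y →L[ℝ] ℝ := g.comp Y.subtypeL
    have hf : ‖g‖ = ‖f‖ := by
      apply le_antisymm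
      · refine g.opNorm_le_bound (norm_nonneg f) fun x => ?_
        have : g x = f ⟨P x, hPm x⟩ := by
          conv_lhs => rw [← (hGm g).1 hg]
          rfl
        rw [this]
        refine (f.le_opNorm _).trans ?_
        gcongr
        refine (P.le_opNorm x).trans ?_
        exact mul_le_of_le_one_left (norm_nonneg _) h1
      · refine f.opNorm_le_bound (norm_nonneg g) fun y => ?_
        exact g.le_opNorm y
    have u := (hU f).unique (y₁ := g) (y₂ := g + h) ⟨fun y => rfl, hf⟩
      ⟨fun y => by rw [ContinuousLinearMap.add_apply, hh y y.2, add_zero]; rfl, by rw [← heq, hf]⟩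
    simpa using u

end HBaux

open HBaux in
theorem stmt13 (Y : Submodule ℝ C₀(ℕ, ℝ)) [FiniteDimensional ℝ Y] :
    PropHB Y ↔
      PropU Y ∧ ∃ P : C₀(ℕ, ℝ) →L[ℝ] C₀(ℕ, ℝ), P.comp P = P ∧ ‖P‖ ≤ 1 ∧
        ‖ContinuousLinearMap.id ℝ C₀(ℕ, ℝ) - P‖ ≤ 1 ∧
        LinearMap.range P.toLinearMap = Y ∧
        IsL1Predual.{v} ↥Y ∧
        IsL1Predual.{v} ↥(LinearMap.range (ContinuousLinearMap.id ℝ C₀(ℕ, ℝ) - P).toLinearMap) := by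
  constructor
  swap
  · rintro ⟨hU, P, hPP, h1, h2, hr, -, -⟩
    exact HB_of_U Y hU P hPP h1 h2 hr
  rintro ⟨G, -, hG, hs⟩
  refine ⟨propU_of_HB Y G hG fun g hg h hh h0 => (hs g hg h hh h0).1, ?_⟩
  obtain ⟨P, hPm, hPy, hPG⟩ := exists_proj Y G hG
  have hPP : ∀ x, P (P x) = P x := fun x => hPy _ (hPm x)
  have hann : ∀ f : C₀(ℕ, ℝ) →L[ℝ] ℝ, f - f.comp P ∈ annih Y := by
    intro f y hy
    simp [hPy y hy]
  have hst : ∀ f : C₀(ℕ, ℝ) →L[ℝ] ℝ, f - f.comp P ≠ 0 → ‖f.comp P‖ < ‖f‖ ∧ ‖f - f.comp P‖ ≤ ‖f‖ := by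
    intro f hf
    have := hs _ (hPG f) _ (hann f) hf
    simpa using this
  have hle : ∀ f : C₀(ℕ, ℝ) →L[ℝ] ℝ, ‖f.comp P‖ ≤ ‖f‖ ∧ ‖f - f.comp P‖ ≤ ‖f‖ := by
    intro f
    by_cases hf : f - f.comp P = 0
    · have hf2 : f = f.comp P := sub_eq_zero.1 hf
      rw [hf, ← hf2]
      exact ⟨le_rfl, (ContinuousLinearMap.opNorm_zero (𝕜 := ℝ) (E := C₀(ℕ, ℝ)) (F := ℝ)).le.trans
        (norm_nonneg f)⟩
    · exact ⟨(hst f hf).1.le, (hst f hf).2⟩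
  have n1 : ∀ x, ‖P x‖ ≤ ‖x‖ := by
    intro x
    refine (norm_le' (norm_nonneg _)).2 fun i => ?_
    refine (((ev i).comp P).le_opNorm x).trans ?_
    exact mul_le_of_le_one_left (norm_nonneg _) ((hle _).1.trans (ev_norm i))
  have n2 : ∀ x, ‖x - P x‖ ≤ ‖x‖ := by
    intro x
    refine (norm_le' (norm_nonneg _)).2 fun i => ?_
    refine ((ev i - (ev i).comp P).le_opNorm x).trans ?_
    exact mul_le_of_le_one_left (norm_nonneg _) ((hle _).2.trans (ev_norm i))
  have hcoord : ∀ i, (∀ x, P x i = x i) ∨ (∀ x, P x i = 0) := by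
    intro i
    obtain ⟨j, s, hs1, hT⟩ := invol ((2 : ℝ) • P - ContinuousLinearMap.id ℝ _)
      (fun x => by simpa using refl_contr P n1 n2 x)
      (fun x => by
        simp only [ContinuousLinearMap.sub_apply, ContinuousLinearMap.smul_apply,
          ContinuousLinearMap.id_apply, map_sub, map_smul, hPP]
        module) i
    have hT' : ∀ x, P x i = (x i + s * x j) / 2 := by
      intro x
      have := hT x
      simp only [ContinuousLinearMap.sub_apply, ContinuousLinearMap.smul_apply,
          ContinuousLinearMap.id_apply, ZeroAtInftyContinuousMap.sub_apply,
          ZeroAtInftyContinuousMap.smul_apply, smul_eq_mul] at this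
      linarith
    by_cases hij : j = i
    · subst hij
      rcases hs1 with h | h
      · left; intro x; rw [hT', h]; ring
      · right; intro x; rw [hT', h]; ring
    · exfalso
      have hij' : i ≠ j := fun h => hij h.symm
      have hne : ev i - (ev i).comp P ≠ 0 := by
        intro h
        have := congrArg (fun f : C₀(ℕ, ℝ) →L[ℝ] ℝ => f (ee i)) h
        simp [ev_apply, hT', ee_apply, hij] at this
        norm_num at this
      have hlt := (hst _ hne).1.trans_le (ev_norm i)
      have hv : ‖ee i + s • ee j‖ ≤ 1 := by
        refine (norm_le' zero_le_one).2 fun k => ?_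
        simp only [ZeroAtInftyContinuousMap.add_apply, ZeroAtInftyContinuousMap.smul_apply, ee_apply]
        by_cases hk : k = i
        · simp [hk, hij']
        · by_cases hk' : k = j
          · rcases hs1 with h | h <;> simp [hk', hij, h]
          · simp [hk, hk']
      have hval : ((ev i).comp P) (ee i + s • ee j) = 1 := by
        rw [ContinuousLinearMap.comp_apply, ev_apply, hT']
        rcases hs1 with h | h <;> simp [ee_apply, hij, hij', h] <;> norm_num
      have := ((ev i).comp P).le_opNorm (ee i + s • ee j)
      rw [hval, norm_one] at this
      have h3 : ‖(ev i).comp P‖ * ‖ee i + s • ee j‖ ≤ ‖(ev i).comp P‖ * 1 := by gcongr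
      linarith
  have hrange : LinearMap.range P.toLinearMap = Y := by
    ext y; constructor
    · rintro ⟨x, rfl⟩; exact hPm x
    · intro hy; exact ⟨y, hPy y hy⟩
  refine ⟨P, ?_, ?_, ?_, hrange, ?_, ?_⟩
  · ext x : 1; exact hPP x
  · exact P.opNorm_le_bound zero_le_one fun x => by simpa using n1 x
  · exact ContinuousLinearMap.opNorm_le_bound _ zero_le_one fun x => by simpa using n2 x
  · refine l1_coord {i | ∀ x, P x i = x i} Y fun x => ⟨fun hx i hi => ?_, fun hx => ?_⟩
    · rw [← hPy x hx]; exact (hcoord i).resolve_left hi x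
    · have : P x = x := by
        ext i
        by_cases hi : ∀ x, P x i = x i
        · exact hi x
        · rw [(hcoord i).resolve_left hi x, hx i hi]
      rw [← this]; exact hPm x
  · refine l1_coord {i | ¬ ∀ x, P x i = x i} _ fun x => ⟨?_, fun hx => ?_⟩
    · rintro ⟨z, rfl⟩ i hi
      simp only [Set.mem_setOf_eq, not_not] at hi
      change z i - P z i = 0
      rw [hi z, sub_self]
    · refine ⟨x, ?_⟩
      ext i
      change x i - P x i = x i
      by_cases hi : ∀ x, P x i = x i
      · rw [hi x, hx i (by simpa using hi), sub_self]
      · rw [(hcoord i).resolve_left hi x, sub_zero]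

end
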